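/- Every smooth symmetric 2-tensor T_{ab} on U that is traceless, Σ_{a,b} h⁰^{ab}T_{ab} = 0, and curl-free, Σ_{c,d} ε_a{}^{cd} D_cT_{db} = 0, is annihilated by (□ - 3): Σ_{c,d} h⁰^{cd} D_dD_cT_{ab} = 3 T_{ab} at every point of U. -/

import Mathlib

noncomputable section

/-- Points of the chart `U = ℝ × (0,π) × ℝ` with coordinates `(τ, θ, φ)`. -/
abbrev Pt : Type := Fin 3 → ℝ

/-- The coordinate domain `U = ℝ × (0,π) × ℝ`. -/
def U : Set Pt := {x | 0 < x 1 ∧ x 1 < Real.pi}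

/-- Partial derivative `∂_i f` at `x`. -/
noncomputable def pd (i : Fin 3) (f : Pt → ℝ) (x : Pt) : ℝ :=
  deriv (fun t => f (Function.update x i t)) (x i)

/-- The unit-hyperboloid (dS₃) metric `h⁰_{ab}`. -/
noncomputable def h0 (x : Pt) : Fin 3 → Fin 3 → ℝ :=
  ![![-1, 0, 0],
    ![0, Real.cosh (x 0) ^ 2, 0],
    ![0, 0, Real.cosh (x 0) ^ 2 * Real.sin (x 1) ^ 2]]

/-- The inverse metric `h⁰^{ab}`. -/
noncomputable def h0inv (x : Pt) : Fin 3 → Fin 3 → ℝ :=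
  ![![-1, 0, 0],
    ![0, 1 / Real.cosh (x 0) ^ 2, 0],
    ![0, 0, 1 / (Real.cosh (x 0) ^ 2 * Real.sin (x 1) ^ 2)]]

/-- Christoffel symbols `Γ^c_{ab}` of `h⁰`; first index is the upper index. -/
noncomputable def Chr (x : Pt) : Fin 3 → Fin 3 → Fin 3 → ℝ :=
  ![![![0, 0, 0],
      ![0, Real.sinh (x 0) * Real.cosh (x 0), 0],
      ![0, 0, Real.sinh (x 0) * Real.cosh (x 0) * Real.sin (x 1) ^ 2]],
    ![![0, Real.tanh (x 0), 0],
      ![Real.tanh (x 0), 0, 0],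
      ![0, 0, -(Real.sin (x 1) * Real.cos (x 1))]],
    ![![0, 0, Real.tanh (x 0)],
      ![0, 0, Real.cos (x 1) / Real.sin (x 1)],
      ![Real.tanh (x 0), Real.cos (x 1) / Real.sin (x 1), 0]]]

/-- Covariant Hessian `D_a D_b f = ∂_a ∂_b f - Σ_c Γ^c_{ab} ∂_c f`. -/
noncomputable def hess (f : Pt → ℝ) (x : Pt) (a b : Fin 3) : ℝ :=
  pd a (pd b f) x - ∑ c, Chr x c a b * pd c f x

/-- Covariant derivative `D_c T_{ab}` of a 2-tensor. -/
noncomputable def covD (T : Pt → Fin 3 → Fin 3 → ℝ) (x : Pt) (c a b : Fin 3) : ℝ :=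
  pd c (fun y => T y a b) x - (∑ d, Chr x d c a * T x d b) - (∑ d, Chr x d c b * T x a d)

/-- Second covariant derivative `D_d D_c T_{ab}`, treating `D_c T_{ab}` as a 3-tensor. -/
noncomputable def covD2 (T : Pt → Fin 3 → Fin 3 → ℝ) (x : Pt) (d c a b : Fin 3) : ℝ :=
  pd d (fun y => covD T y c a b) x
    - (∑ e, Chr x e d c * covD T x e a b)
    - (∑ e, Chr x e d a * covD T x c e b)
    - (∑ e, Chr x e d b * covD T x c a e)

/-- Tensor Laplacian `□T_{ab} = Σ_{c,d} h⁰^{cd} D_d D_c T_{ab}`. -/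
noncomputable def boxT (T : Pt → Fin 3 → Fin 3 → ℝ) (x : Pt) (a b : Fin 3) : ℝ :=
  ∑ c, ∑ d, h0inv x c d * covD2 T x d c a b

/-- Totally antisymmetric Levi-Civita symbol with `levi 0 1 2 = 1`. -/
def levi : Fin 3 → Fin 3 → Fin 3 → ℝ :=
  ![![![0, 0, 0], ![0, 0, 1], ![0, -1, 0]],
    ![![0, 0, -1], ![0, 0, 0], ![1, 0, 0]],
    ![![0, 1, 0], ![-1, 0, 0], ![0, 0, 0]]]

/-- Volume tensor `ε_{abc}` with `ε_{τθφ} = cosh²τ sinθ`. -/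
noncomputable def epsLow (x : Pt) (a b c : Fin 3) : ℝ :=
  levi a b c * (Real.cosh (x 0) ^ 2 * Real.sin (x 1))

/-- `ε_a{}^{cd} = Σ_{e,f} ε_{aef} h⁰^{ec} h⁰^{fd}`. -/
noncomputable def epsMixed (x : Pt) (a c d : Fin 3) : ℝ :=
  ∑ e, ∑ f, epsLow x a e f * h0inv x e c * h0inv x f d

/-- Curl of a 2-tensor: `(curl T)_{ab} = Σ_{c,d} ε_a{}^{cd} D_c T_{db}`. -/
noncomputable def curlT (T : Pt → Fin 3 → Fin 3 → ℝ) (x : Pt) (a b : Fin 3) : ℝ :=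
  ∑ c, ∑ d, epsMixed x a c d * covD T x c d b

open scoped Topology

lemma isOpen_U : IsOpen U :=
  (isOpen_lt continuous_const (continuous_apply 1)).inter
    (isOpen_lt (continuous_apply 1) continuous_const)

section PartialDerivatives

variable {f g : Pt → ℝ} {x : Pt}

lemma pd_eq_fderiv (i : Fin 3) (hf : DifferentiableAt ℝ f x) :
    pd i f x = fderiv ℝ f x (Pi.single i 1) := by
  have h := hasDerivAt_update x i (x i)
  have hf' : HasFDerivAt f (fderiv ℝ f x) (Function.update x i (x i)) := by
    simpa using hf.hasFDerivAt
  exact (hf'.comp_hasDerivAt (x i) h).deriv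

lemma pd_congr (i : Fin 3) (h : f =ᶠ[𝓝 x] g) : pd i f x = pd i g x := by
  have hc : Filter.Tendsto (fun t => Function.update x i t) (𝓝 (x i)) (𝓝 x) := by
    have := (hasDerivAt_update x i (x i)).continuousAt.tendsto
    simpa using this
  exact Filter.EventuallyEq.deriv_eq (hc.eventually h)

lemma pd_congr_on (i : Fin 3) (hx : x ∈ U) (h : ∀ y ∈ U, f y = g y) : pd i f x = pd i g x :=
  pd_congr i (Filter.eventually_of_mem (isOpen_U.mem_nhds hx) h)

lemma pd_zero (i : Fin 3) : pd i (fun _ => 0) x = 0 := by simp [pd]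

lemma pd_sub (i : Fin 3) (hf : DifferentiableAt ℝ f x) (hg : DifferentiableAt ℝ g x) :
    pd i (fun y => f y - g y) x = pd i f x - pd i g x := by
  rw [pd_eq_fderiv i hf, pd_eq_fderiv i hg, pd_eq_fderiv i (hf.fun_sub hg), fderiv_fun_sub hf hg]
  rfl

lemma pd_mul (i : Fin 3) (hf : DifferentiableAt ℝ f x) (hg : DifferentiableAt ℝ g x) :
    pd i (fun y => f y * g y) x = pd i f x * g x + f x * pd i g x := by
  rw [pd_eq_fderiv i hf, pd_eq_fderiv i hg, pd_eq_fderiv i (hf.fun_mul hg), fderiv_fun_mul hf hg]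
  simp
  ring

lemma pd_sum {ι : Type*} (s : Finset ι) {F : ι → Pt → ℝ} (i : Fin 3)
    (hF : ∀ j ∈ s, DifferentiableAt ℝ (F j) x) :
    pd i (fun y => ∑ j ∈ s, F j y) x = ∑ j ∈ s, pd i (F j) x := by
  rw [pd_eq_fderiv i (DifferentiableAt.fun_sum hF), fderiv_fun_sum hF,
    sum_apply]
  exact Finset.sum_congr rfl fun j hj => (pd_eq_fderiv i (hF j hj)).symm

lemma differentiableAt_of_contDiffOn_U (hf : ContDiffOn ℝ (⊤ : ℕ∞) f U) (hx : x ∈ U) :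
    DifferentiableAt ℝ f x :=
  (hf.contDiffAt (isOpen_U.mem_nhds hx)).differentiableAt (by simp)

lemma contDiffOn_pd (i : Fin 3) (hf : ContDiffOn ℝ (⊤ : ℕ∞) f U) :
    ContDiffOn ℝ (⊤ : ℕ∞) (pd i f) U := by
  have h : ContDiffOn ℝ (⊤ : ℕ∞) (fun y => fderiv ℝ f y (Pi.single i 1)) U :=
    (hf.fderiv_of_isOpen isOpen_U (by simp)).clm_apply contDiffOn_const
  exact h.congr fun y hy => pd_eq_fderiv i (differentiableAt_of_contDiffOn_U hf hy)

lemma pd_comm (i j : Fin 3) (hf : ContDiffOn ℝ (⊤ : ℕ∞) f U) (hx : x ∈ U) :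
    pd i (pd j f) x = pd j (pd i f) x := by
  have hd : DifferentiableAt ℝ (fderiv ℝ f) x :=
    (((hf.fderiv_of_isOpen (m := (⊤ : ℕ∞)) isOpen_U (by simp)).contDiffAt
      (isOpen_U.mem_nhds hx))).differentiableAt (by simp)
  have key (k l : Fin 3) : pd k (pd l f) x
      = fderiv ℝ (fderiv ℝ f) x (Pi.single k 1) (Pi.single l 1) := by
    rw [pd_congr_on k hx fun y hy => pd_eq_fderiv l (differentiableAt_of_contDiffOn_U hf hy),
      pd_eq_fderiv k (hd.clm_apply (differentiableAt_const _)),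
      fderiv_clm_apply hd (differentiableAt_const _)]
    simp
  have hs : IsSymmSndFDerivAt ℝ f x :=
    (hf.contDiffAt (isOpen_U.mem_nhds hx)).isSymmSndFDerivAt (by
      simpa using WithTop.coe_le_coe.2 (le_top : (2 : ℕ∞) ≤ ⊤))
  rw [key, key, hs.eq]

end PartialDerivatives

section Geometry

variable {x : Pt}

lemma cosh_ne_zero (t : ℝ) : Real.cosh t ≠ 0 := (Real.cosh_pos t).ne'

lemma sin_ne_zero_of_mem_U (hx : x ∈ U) : Real.sin (x 1) ≠ 0 :=
  (Real.sin_pos_of_pos_of_lt_pi hx.1 hx.2).ne'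

lemma contDiffOn_h0inv (a b : Fin 3) : ContDiffOn ℝ (⊤ : ℕ∞) (fun y => h0inv y a b) U := by
  intro x hx
  have hs := sin_ne_zero_of_mem_U hx
  have hc := cosh_ne_zero (x 0)
  apply ContDiffAt.contDiffWithinAt
  fin_cases a <;> fin_cases b <;> simp [h0inv] <;> fun_prop (disch := positivity)

lemma contDiffOn_Chr (a b c : Fin 3) : ContDiffOn ℝ (⊤ : ℕ∞) (fun y => Chr y a b c) U := by
  intro x hx
  have hs := sin_ne_zero_of_mem_U hx
  have hc := cosh_ne_zero (x 0)
  apply ContDiffAt.contDiffWithinAt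
  fin_cases a <;> fin_cases b <;> fin_cases c <;> simp [Chr, Real.tanh_eq_sinh_div_cosh] <;>
    fun_prop (disch := assumption)

lemma Chr_symm (x : Pt) (a b c : Fin 3) : Chr x a b c = Chr x a c b := by
  fin_cases a <;> fin_cases b <;> fin_cases c <;> rfl

/-- The partial derivatives `∂_d Γ^a_{bc}`. -/
def dChr (x : Pt) : Fin 3 → Fin 3 → Fin 3 → Fin 3 → ℝ :=
  ![![![![0, 0, 0],
        ![0, Real.cosh (x 0) ^ 2 + Real.sinh (x 0) ^ 2, 0],
        ![0, 0, (Real.cosh (x 0) ^ 2 + Real.sinh (x 0) ^ 2) * Real.sin (x 1) ^ 2]],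
      ![![0, 1 / Real.cosh (x 0) ^ 2, 0],
        ![1 / Real.cosh (x 0) ^ 2, 0, 0],
        ![0, 0, 0]],
      ![![0, 0, 1 / Real.cosh (x 0) ^ 2],
        ![0, 0, 0],
        ![1 / Real.cosh (x 0) ^ 2, 0, 0]]],
    ![![![0, 0, 0],
        ![0, 0, 0],
        ![0, 0, 2 * Real.sinh (x 0) * Real.cosh (x 0) * Real.sin (x 1) * Real.cos (x 1)]],
      ![![0, 0, 0],
        ![0, 0, 0],
        ![0, 0, Real.sin (x 1) ^ 2 - Real.cos (x 1) ^ 2]],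
      ![![0, 0, 0],
        ![0, 0, -(1 / Real.sin (x 1) ^ 2)],
        ![0, -(1 / Real.sin (x 1) ^ 2), 0]]],
    0]

lemma hasDerivAt_tanh (t : ℝ) : HasDerivAt Real.tanh (1 / Real.cosh t ^ 2) t := by
  have e : Real.tanh = fun s => Real.sinh s / Real.cosh s := funext Real.tanh_eq_sinh_div_cosh
  rw [e]
  refine ((Real.hasDerivAt_sinh t).fun_div (Real.hasDerivAt_cosh t) (cosh_ne_zero t)).congr_deriv ?_
  congr 1
  linarith [Real.cosh_sq t]

lemma hasDerivAt_cot {t : ℝ} (ht : Real.sin t ≠ 0) :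
    HasDerivAt (fun s => Real.cos s / Real.sin s) (-(1 / Real.sin t ^ 2)) t := by
  refine ((Real.hasDerivAt_cos t).fun_div (Real.hasDerivAt_sin t) ht).congr_deriv ?_
  rw [← neg_div]
  congr 1
  linarith [Real.sin_sq_add_cos_sq t]

lemma hasDerivAt_sinh_mul_cosh (t : ℝ) :
    HasDerivAt (fun s => Real.sinh s * Real.cosh s) (Real.cosh t ^ 2 + Real.sinh t ^ 2) t :=
  ((Real.hasDerivAt_sinh t).fun_mul (Real.hasDerivAt_cosh t)).congr_deriv (by ring)

lemma hasDerivAt_sin_mul_cos (t : ℝ) :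
    HasDerivAt (fun s => Real.sin s * Real.cos s) (Real.cos t ^ 2 - Real.sin t ^ 2) t :=
  ((Real.hasDerivAt_sin t).fun_mul (Real.hasDerivAt_cos t)).congr_deriv (by ring)

lemma hasDerivAt_sin_sq (t : ℝ) :
    HasDerivAt (fun s => Real.sin s ^ 2) (2 * Real.sin t * Real.cos t) t :=
  ((Real.hasDerivAt_sin t).fun_pow 2).congr_deriv (by ring)

lemma hasDerivAt_inv_cosh_sq (t : ℝ) :
    HasDerivAt (fun s => (Real.cosh s ^ 2)⁻¹)
      (-2 * Real.tanh t * (Real.cosh t ^ 2)⁻¹) t := by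
  have hc := cosh_ne_zero t
  refine (((Real.hasDerivAt_cosh t).fun_pow 2).fun_inv (pow_ne_zero 2 hc)).congr_deriv ?_
  rw [Real.tanh_eq_sinh_div_cosh]
  field_simp
  ring

lemma hasDerivAt_inv_sin_sq {t : ℝ} (ht : Real.sin t ≠ 0) :
    HasDerivAt (fun s => (Real.sin s ^ 2)⁻¹)
      (-2 * (Real.cos t / Real.sin t) * (Real.sin t ^ 2)⁻¹) t := by
  refine (((Real.hasDerivAt_sin t).fun_pow 2).fun_inv (pow_ne_zero 2 ht)).congr_deriv ?_
  field_simp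
  ring

lemma pd_Chr (hx : x ∈ U) (d a b c : Fin 3) :
    pd d (fun y => Chr y a b c) x = dChr x d a b c := by
  have hs := sin_ne_zero_of_mem_U hx
  fin_cases d <;> fin_cases a <;> fin_cases b <;> fin_cases c <;>
    simp [pd, Chr, dChr, (hasDerivAt_tanh _).deriv, (hasDerivAt_cot hs).deriv,
      (hasDerivAt_sinh_mul_cosh _).deriv, (hasDerivAt_sin_mul_cos _).deriv,
      (hasDerivAt_sin_sq _).deriv] <;> ring

lemma pd_h0inv (hx : x ∈ U) (c a b : Fin 3) :
    pd c (fun y => h0inv y a b) x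
      = -(∑ e, Chr x a c e * h0inv x e b) - ∑ e, Chr x b c e * h0inv x a e := by
  have hs := sin_ne_zero_of_mem_U hx
  have hc := cosh_ne_zero (x 0)
  fin_cases c <;> fin_cases a <;> fin_cases b <;>
    simp [pd, Chr, h0inv, Fin.sum_univ_three, (hasDerivAt_inv_cosh_sq _).deriv,
      (hasDerivAt_inv_sin_sq hs).deriv,
      Real.tanh_eq_sinh_div_cosh] <;> field_simp <;> ring

/-- The Riemann tensor of the unit hyperboloid is that of a space of constant curvature one. -/
lemma riemann_h0 (hx : x ∈ U) (e c d a : Fin 3) :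
    dChr x d e a c - dChr x a e d c
        + ∑ f, (Chr x e d f * Chr x f a c - Chr x e a f * Chr x f d c)
      = (if e = d then h0 x a c else 0) - (if e = a then h0 x d c else 0) := by
  have hs := sin_ne_zero_of_mem_U hx
  have hc := cosh_ne_zero (x 0)
  have h1 := Real.cosh_sq (x 0)
  have h2 := Real.sin_sq_add_cos_sq (x 1)
  fin_cases e <;> fin_cases c <;> fin_cases d <;> fin_cases a <;>
    simp [Chr, dChr, h0, Fin.sum_univ_three, Real.tanh_eq_sinh_div_cosh] <;> field_simp <;> grind

end Geometry

section Codazzi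

variable {T : Pt → Fin 3 → Fin 3 → ℝ} {x : Pt}

lemma contDiffOn_covD (hT : ∀ a b : Fin 3, ContDiffOn ℝ (⊤ : ℕ∞) (fun x => T x a b) U)
    (c a b : Fin 3) : ContDiffOn ℝ (⊤ : ℕ∞) (fun y => covD T y c a b) U :=
  ((contDiffOn_pd c (hT a b)).sub
    (ContDiffOn.sum fun d _ => (contDiffOn_Chr d c a).mul (hT d b))).sub
    (ContDiffOn.sum fun d _ => (contDiffOn_Chr d c b).mul (hT a d))

lemma covD_symm (hsym : ∀ x ∈ U, ∀ a b : Fin 3, T x a b = T x b a) (hx : x ∈ U)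
    (c a b : Fin 3) : covD T x c a b = covD T x c b a := by
  have h1 := pd_congr_on c hx fun y hy => hsym y hy a b
  simp only [covD, h1, hsym x hx _ b, hsym x hx a]
  ring

/-- A curl-free 2-tensor is a Codazzi tensor. -/
lemma covD_comm_of_curlT_eq_zero (hcurl : ∀ a b : Fin 3, curlT T x a b = 0) (hx : x ∈ U)
    (c a b : Fin 3) : covD T x c a b = covD T x a c b := by
  have hs := sin_ne_zero_of_mem_U hx
  have hc := cosh_ne_zero (x 0)
  have k0 := hcurl 0 b
  have k1 := hcurl 1 b
  have k2 := hcurl 2 b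
  simp [curlT, epsMixed, epsLow, levi, h0inv, Fin.sum_univ_three] at k0 k1 k2
  field_simp at k0 k1 k2
  replace k2 := (mul_eq_zero.1 k2).resolve_left hs
  fin_cases c <;> fin_cases a <;> simp <;> linarith

lemma sum_h0inv_mul_covD_eq_zero
    (hT : ∀ a b : Fin 3, ContDiffOn ℝ (⊤ : ℕ∞) (fun x => T x a b) U)
    (htr : ∀ x ∈ U, (∑ a, ∑ b, h0inv x a b * T x a b) = 0) (hx : x ∈ U) (c : Fin 3) :
    ∑ a, ∑ b, h0inv x a b * covD T x c a b = 0 := by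
  have hdT (a b : Fin 3) := differentiableAt_of_contDiffOn_U (hT a b) hx
  have hdh (a b : Fin 3) := differentiableAt_of_contDiffOn_U (contDiffOn_h0inv a b) hx
  have h := pd_congr_on c hx htr
  rw [pd_zero, pd_sum _ _ fun a _ => .fun_sum fun b _ => (hdh a b).fun_mul (hdT a b)] at h
  simp only [pd_sum _ c fun b _ => (hdh _ b).fun_mul (hdT _ b), pd_mul c (hdh _ _) (hdT _ _),
    pd_h0inv hx] at h
  rw [← h]
  simp only [covD, Fin.sum_univ_three]
  ring

lemma sum_h0inv_mul_covD2_eq_zero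
    (hT : ∀ a b : Fin 3, ContDiffOn ℝ (⊤ : ℕ∞) (fun x => T x a b) U)
    (hdiv : ∀ x ∈ U, ∀ b, (∑ c, ∑ d, h0inv x c d * covD T x d c b) = 0) (hx : x ∈ U)
    (a b : Fin 3) :
    ∑ c, ∑ d, h0inv x c d * covD2 T x a d c b = 0 := by
  have hdT (c a b : Fin 3) := differentiableAt_of_contDiffOn_U (contDiffOn_covD hT c a b) hx
  have hdh (a b : Fin 3) := differentiableAt_of_contDiffOn_U (contDiffOn_h0inv a b) hx
  have h := pd_congr_on a hx fun y hy => hdiv y hy b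
  rw [pd_zero, pd_sum _ _ fun c _ => .fun_sum fun d _ => (hdh c d).fun_mul (hdT d c b)] at h
  simp only [pd_sum _ a fun d _ => (hdh _ d).fun_mul (hdT d _ b), pd_mul a (hdh _ _) (hdT _ _ _),
    pd_h0inv hx] at h
  have h0 := hdiv x hx 0
  have h1 := hdiv x hx 1
  have h2 := hdiv x hx 2
  simp only [covD2, Fin.sum_univ_three] at h h0 h1 h2 ⊢
  linear_combination h - Chr x 0 a b * h0 - Chr x 1 a b * h1 - Chr x 2 a b * h2

lemma covD2_comm_of_codazzi
    (hcod : ∀ x ∈ U, ∀ c a b, covD T x c a b = covD T x a c b) (hx : x ∈ U)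
    (d c a b : Fin 3) : covD2 T x d c a b = covD2 T x d a c b := by
  have h := pd_congr_on d hx fun y hy => hcod y hy c a b
  simp only [covD2, h, hcod x hx _ a, hcod x hx c]
  ring

lemma pd_covD (hT : ∀ a b : Fin 3, ContDiffOn ℝ (⊤ : ℕ∞) (fun x => T x a b) U) (hx : x ∈ U)
    (d c a b : Fin 3) :
    pd d (fun y => covD T y c a b) x = pd d (pd c fun y => T y a b) x
      - (∑ e, (dChr x d e c a * T x e b + Chr x e c a * pd d (fun y => T y e b) x))
      - ∑ e, (dChr x d e c b * T x a e + Chr x e c b * pd d (fun y => T y a e) x) := by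
  have hdT (a b : Fin 3) := differentiableAt_of_contDiffOn_U (hT a b) hx
  have hdC (a b c : Fin 3) := differentiableAt_of_contDiffOn_U (contDiffOn_Chr a b c) hx
  have hd := differentiableAt_of_contDiffOn_U (contDiffOn_pd c (hT a b)) hx
  have h1 : ∀ e ∈ Finset.univ, DifferentiableAt ℝ (fun y => Chr y e c a * T y e b) x :=
    fun e _ => (hdC e c a).fun_mul (hdT e b)
  have h2 : ∀ e ∈ Finset.univ, DifferentiableAt ℝ (fun y => Chr y e c b * T y a e) x :=
    fun e _ => (hdC e c b).fun_mul (hdT a e)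
  unfold covD
  rw [pd_sub d (hd.fun_sub (.fun_sum h1)) (.fun_sum h2), pd_sub d hd (.fun_sum h1),
    pd_sum _ d h1, pd_sum _ d h2]
  simp only [pd_mul d (hdC _ _ _) (hdT _ _), pd_Chr hx]

/-- The Ricci identity for 2-tensors. -/
lemma covD2_sub_covD2 (hT : ∀ a b : Fin 3, ContDiffOn ℝ (⊤ : ℕ∞) (fun x => T x a b) U)
    (hx : x ∈ U) (d a c b : Fin 3) :
    covD2 T x d a c b - covD2 T x a d c b
      = -(∑ e, ((if e = d then h0 x a c else 0) - (if e = a then h0 x d c else 0)) * T x e b)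
        - ∑ e, ((if e = d then h0 x a b else 0) - (if e = a then h0 x d b else 0)) * T x c e := by
  simp only [← riemann_h0 hx]
  simp only [covD2, pd_covD hT hx, pd_comm a d (hT c b) hx, Chr_symm x _ a d]
  simp only [covD, Fin.sum_univ_three]
  ring

lemma sum_h0inv_mul_riemann (hx : x ∈ U) (S : Fin 3 → Fin 3 → ℝ) (hS : ∀ a b, S a b = S b a)
    (htr : ∑ a, ∑ b, h0inv x a b * S a b = 0) (a b : Fin 3) :
    ∑ c, ∑ d, h0inv x c d *
      (-(∑ e, ((if e = d then h0 x a c else 0) - (if e = a then h0 x d c else 0)) * S e b)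
        - ∑ e, ((if e = d then h0 x a b else 0) - (if e = a then h0 x d b else 0)) * S c e)
      = 3 * S a b := by
  have hs := sin_ne_zero_of_mem_U hx
  have hc := cosh_ne_zero (x 0)
  have h01 := hS 0 1
  have h02 := hS 0 2
  have h12 := hS 1 2
  simp [h0inv, Fin.sum_univ_three] at htr
  field_simp at htr
  fin_cases a <;> fin_cases b <;> simp [h0inv, h0, Fin.sum_univ_three] <;> field_simp <;> grind

end Codazzi

/-- Every smooth symmetric traceless curl-free 2-tensor on `U` satisfies `□T_{ab} = 3T_{ab}`. -/
theorem stmt10 (T : Pt → Fin 3 → Fin 3 → ℝ)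
    (hT : ∀ a b : Fin 3, ContDiffOn ℝ (⊤ : ℕ∞) (fun x => T x a b) U)
    (hsym : ∀ x ∈ U, ∀ a b : Fin 3, T x a b = T x b a)
    (htr : ∀ x ∈ U, (∑ a, ∑ b, h0inv x a b * T x a b) = 0)
    (hcurl : ∀ x ∈ U, ∀ a b : Fin 3, curlT T x a b = 0) :
    ∀ x ∈ U, ∀ a b : Fin 3, boxT T x a b = 3 * T x a b := by
  intro x hx a b
  have hcod : ∀ x ∈ U, ∀ c a b, covD T x c a b = covD T x a c b :=
    fun x hx => covD_comm_of_curlT_eq_zero (hcurl x hx) hx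
  have hdiv : ∀ x ∈ U, ∀ b, (∑ c, ∑ d, h0inv x c d * covD T x d c b) = 0 := by
    intro x hx b
    rw [← sum_h0inv_mul_covD_eq_zero hT htr hx b]
    refine Finset.sum_congr rfl fun c _ => Finset.sum_congr rfl fun d _ => ?_
    rw [hcod x hx d c b, covD_symm hsym hx c d b, hcod x hx c b d, covD_symm hsym hx]
  rw [← sum_h0inv_mul_riemann hx (T x) (hsym x hx) (htr x hx) a b]
  simp only [← covD2_sub_covD2 hT hx, mul_sub, Finset.sum_sub_distrib,
    sum_h0inv_mul_covD2_eq_zero hT hdiv hx, sub_zero, boxT]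
  simp only [covD2_comm_of_codazzi hcod hx _ _ a]
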